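/- If u > 0 is a real number and α, β ∈ (0, π/2) satisfy α + 4·β = π, sin α = u and sin β = 2·u, then u does not belong to Qclo(ℚ). (This expresses that the cyclic pentagon with side lengths 1, 2, 2, 2, 2 exists but is not constructible with straightedge and compass from its side lengths, so 5 ∈ NCL₂.) -/

import Mathlib

open Real

/-- The real quadratic closure of a subfield `K` of `ℝ`: the smallest subfield of `ℝ`
containing `K` that is closed under real square roots. -/
noncomputable def Qclo (K : Subfield ℝ) : Subfield ℝ :=
  sInf {M : Subfield ℝ | K ≤ M ∧ ∀ c : ℝ, c ∈ M → 0 ≤ c → Real.sqrt c ∈ M}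

/-- For `s ∉ K` with `s ^ 2 ∈ K`, the quadratic extension `K(s) = {a + b * s | a, b ∈ K}`. -/
def Subfield.adjoinSqrt (K : Subfield ℝ) (s : ℝ) (hs : s ∉ K) (hd : s ^ 2 ∈ K) : Subfield ℝ where
  carrier := {x | ∃ a ∈ K, ∃ b ∈ K, x = a + b * s}
  zero_mem' := ⟨0, K.zero_mem, 0, K.zero_mem, by ring⟩
  one_mem' := ⟨1, K.one_mem, 0, K.zero_mem, by ring⟩
  add_mem' := by
    rintro _ _ ⟨a, ha, b, hb, rfl⟩ ⟨a', ha', b', hb', rfl⟩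
    exact ⟨a + a', K.add_mem ha ha', b + b', K.add_mem hb hb', by ring⟩
  mul_mem' := by
    rintro _ _ ⟨a, ha, b, hb, rfl⟩ ⟨a', ha', b', hb', rfl⟩
    exact ⟨a * a' + b * b' * s ^ 2,
      K.add_mem (K.mul_mem ha ha') (K.mul_mem (K.mul_mem hb hb') hd),
      a * b' + b * a', K.add_mem (K.mul_mem ha hb') (K.mul_mem hb ha'), by ring⟩
  neg_mem' := by
    rintro _ ⟨a, ha, b, hb, rfl⟩
    exact ⟨-a, K.neg_mem ha, -b, K.neg_mem hb, by ring⟩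
  inv_mem' := by
    rintro _ ⟨a, ha, b, hb, rfl⟩
    by_cases hx : a + b * s = 0
    · exact ⟨0, K.zero_mem, 0, K.zero_mem, by simp [hx]⟩
    have hy : a - b * s ≠ 0 := by
      intro hy
      by_cases hb0 : b = 0
      · simp_all
      · exact hs ((eq_div_of_mul_eq hb0 (by linarith : s * b = a)) ▸ K.div_mem ha hb)
    have hN : a ^ 2 - b ^ 2 * s ^ 2 ∈ K :=
      K.sub_mem (K.pow_mem ha 2) (K.mul_mem (K.pow_mem hb 2) hd)
    refine ⟨a / (a ^ 2 - b ^ 2 * s ^ 2), K.div_mem ha hN,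
      -b / (a ^ 2 - b ^ 2 * s ^ 2), K.div_mem (K.neg_mem hb) hN, ?_⟩
    have hN0 : a ^ 2 - b ^ 2 * s ^ 2 = (a + b * s) * (a - b * s) := by ring
    rw [hN0]
    field_simp
    ring

theorem Subfield.le_adjoinSqrt (K : Subfield ℝ) (s : ℝ) (hs : s ∉ K) (hd : s ^ 2 ∈ K) :
    K ≤ K.adjoinSqrt s hs hd :=
  fun x hx => ⟨x, hx, 0, K.zero_mem, by ring⟩

theorem Subfield.mem_adjoinSqrt_self (K : Subfield ℝ) (s : ℝ) (hs : s ∉ K) (hd : s ^ 2 ∈ K) :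
    s ∈ K.adjoinSqrt s hs hd :=
  ⟨0, K.zero_mem, 1, K.one_mem, by ring⟩

/-- A depressed cubic over `K` without roots in `K` has no roots in a quadratic extension. -/
theorem Subfield.cubic_ne_zero_of_mem_adjoinSqrt (K : Subfield ℝ) (s : ℝ) (hs : s ∉ K)
    (hd : s ^ 2 ∈ K) {p q : ℝ} (hp : p ∈ K) (hq : q ∈ K)
    (hK : ∀ x ∈ K, x ^ 3 + p * x + q ≠ 0) :
    ∀ x ∈ K.adjoinSqrt s hs hd, x ^ 3 + p * x + q ≠ 0 := by
  rintro _ ⟨a, ha, b, hb, rfl⟩ hx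
  set A := a ^ 3 + 3 * a * b ^ 2 * s ^ 2 + p * a + q with hA
  set B := 3 * a ^ 2 + b ^ 2 * s ^ 2 + p with hB
  have h3 : (3 : ℝ) ∈ K := by exact_mod_cast natCast_mem K 3
  have hAK : A ∈ K := K.add_mem (K.add_mem (K.add_mem (K.pow_mem ha 3)
    (K.mul_mem (K.mul_mem (K.mul_mem h3 ha) (K.pow_mem hb 2)) hd)) (K.mul_mem hp ha)) hq
  have hBK : B ∈ K := K.add_mem (K.add_mem (K.mul_mem h3 (K.pow_mem ha 2))
    (K.mul_mem (K.pow_mem hb 2) hd)) hp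
  have hAB : A + b * B * s = 0 := by rw [← hx, hA, hB]; ring
  have hbB : b * B = 0 := by
    by_contra h
    refine hs ((eq_div_of_mul_eq h (by linarith : s * (b * B) = -A)) ▸
      K.div_mem (K.neg_mem hAK) (K.mul_mem hb hBK))
  rcases mul_eq_zero.1 hbB with h | h
  · exact hK a ha (by simpa [h] using hx)
  · have hA0 : A = 0 := by simpa [hbB] using hAB
    refine hK (-(a + a)) (K.neg_mem (K.add_mem ha ha)) ?_
    rw [hA] at hA0
    rw [hB] at h
    linear_combination hA0 - 3 * a * h

/-- A depressed rational cubic without rational roots has no roots in the real quadratic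
closure of `ℚ`. -/
theorem cubic_ne_zero_of_mem_Qclo_bot {p q : ℚ} (h : ∀ x : ℚ, x ^ 3 + p * x + q ≠ 0) :
    ∀ x ∈ Qclo ⊥, x ^ 3 + p * x + q ≠ 0 := by
  have hbot : ∀ x ∈ (⊥ : Subfield ℝ), x ^ 3 + p * x + q ≠ 0 := by
    intro x hx
    rw [Subfield.bot_eq_of_charZero] at hx
    obtain ⟨r, rfl⟩ := hx
    simpa using mod_cast h r
  obtain ⟨K, -, hK⟩ := zorn_le_nonempty₀
    {K : Subfield ℝ | ∀ x ∈ K, x ^ 3 + p * x + q ≠ 0} (by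
      intro C hC hchain K hKC
      refine ⟨sSup C, fun x hx => ?_, fun L hL => le_sSup hL⟩
      obtain ⟨L, hL, hxL⟩ :=
        (Subfield.mem_sSup_of_directedOn ⟨K, hKC⟩ hchain.directedOn).1 hx
      exact hC hL x hxL) ⊥ hbot
  have hle : Qclo ⊥ ≤ K := by
    refine sInf_le ⟨bot_le, fun c hc hc0 => ?_⟩
    by_contra hs
    have hd : √c ^ 2 ∈ K := by rwa [Real.sq_sqrt hc0]
    refine hs (hK.le_of_ge (y := K.adjoinSqrt _ hs hd) ?_ (K.le_adjoinSqrt _ hs hd)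
      (K.mem_adjoinSqrt_self _ hs hd))
    exact K.cubic_ne_zero_of_mem_adjoinSqrt _ hs hd (SubfieldClass.ratCast_mem K p)
      (SubfieldClass.ratCast_mem K q) hK.prop
  exact fun x hx => hK.prop x (hle hx)

theorem rat_cubic_ne_zero (x : ℚ) : x ^ 3 + (-8 : ℚ) * x + (-4 : ℚ) ≠ 0 := by
  intro hx
  obtain ⟨n, rfl⟩ : ∃ n : ℤ, (n : ℚ) = x := by
    have hint : IsIntegral ℤ x := by
      refine ⟨Polynomial.X ^ 3 + (Polynomial.C (-8) * Polynomial.X + Polynomial.C (-4)), ?_, ?_⟩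
      · exact Polynomial.monic_X_pow_add (lt_of_le_of_lt Polynomial.degree_linear_le (by norm_num))
      · simp only [Polynomial.eval₂_add, Polynomial.eval₂_mul, Polynomial.eval₂_pow,
          Polynomial.eval₂_X, Polynomial.eval₂_C]
        rw [← hx]
        norm_num
        ring
    simpa using IsIntegrallyClosed.isIntegral_iff.1 hint
  have hn : n ^ 3 + (-8) * n + (-4) = 0 := by exact_mod_cast hx
  have h1 : n < 4 := by
    by_contra! h
    nlinarith [mul_nonneg (by linarith : (0 : ℤ) ≤ n) (by nlinarith : (0 : ℤ) ≤ n ^ 2 - 16)]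
  have h2 : -4 < n := by
    by_contra! h
    nlinarith [mul_nonneg (by linarith : (0 : ℤ) ≤ -n) (by nlinarith : (0 : ℤ) ≤ n ^ 2 - 16)]
  interval_cases n <;> omega

theorem sqrt_mem_Qclo {K : Subfield ℝ} {c : ℝ} (hc : c ∈ Qclo K) (hc0 : 0 ≤ c) :
    √c ∈ Qclo K :=
  Subfield.mem_sInf.2 fun M hM => hM.2 c (Subfield.mem_sInf.1 hc M hM) hc0

/-- If `u > 0` and `α, β ∈ (0, π/2)` satisfy `α + 4β = π`, `sin α = u`, `sin β = 2u`,
then `u` is not in the real quadratic closure of `ℚ` (the prime subfield `⊥` of `ℝ`);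
i.e., the cyclic pentagon with side lengths `1, 2, 2, 2, 2` is non-constructible. -/
theorem statement8 (u α β : ℝ) (hu : 0 < u)
    (hα : α ∈ Set.Ioo 0 (π / 2)) (hβ : β ∈ Set.Ioo 0 (π / 2))
    (hsum : α + 4 * β = π)
    (h1 : Real.sin α = u) (h2 : Real.sin β = 2 * u) :
    u ∉ Qclo ⊥ := by
  intro hmem
  have hsq : cos β ^ 2 = 1 - (u + u) ^ 2 := by
    rw [Real.cos_sq', h2]; ring
  have hcos : 0 < cos β := Real.cos_pos_of_mem_Ioo ⟨by linarith [hβ.1, Real.pi_pos], hβ.2⟩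
  have hc : cos β ∈ Qclo ⊥ := by
    rw [← Real.sqrt_sq hcos.le]
    refine sqrt_mem_Qclo ?_ (sq_nonneg _)
    rw [hsq]
    exact sub_mem (one_mem _) (pow_mem (add_mem hmem hmem) 2)
  have hsin : u = 8 * u * cos β * (2 * cos β ^ 2 - 1) := by
    have : sin α = sin (2 * (2 * β)) := by
      rw [← Real.sin_pi_sub]; congr 1; linarith
    rw [h1, Real.sin_two_mul, Real.sin_two_mul, Real.cos_two_mul, h2] at this
    linear_combination this
  have hcubic : 1 = 8 * cos β * (2 * cos β ^ 2 - 1) :=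
    mul_left_cancel₀ hu.ne' (by linarith)
  have h4 : (4 : ℝ) ∈ Qclo ⊥ := by exact_mod_cast natCast_mem (Qclo ⊥) 4
  refine cubic_ne_zero_of_mem_Qclo_bot rat_cubic_ne_zero (4 * cos β) (mul_mem h4 hc) ?_
  push_cast
  linear_combination -4 * hcubic
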